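/- For every σ > 0, A > 0 and 0 < α < 1/2, the capacity is lower-bounded as C(A, αA) ≥ (1/2)·log( 1 + (A²/(2πeσ²))·e^{2αμ*}·((1 − e^{−μ*})/μ*)² ), where μ* is the unique positive solution of α = 1/μ* − e^{−μ*}/(1 − e^{−μ*}). -/

import Mathlib

open MeasureTheory ProbabilityTheory Real Filter Set
open scoped Classical Topology

/-- Kullback--Leibler divergence (in nats), valued in the extended reals:
`D(P ∥ R) = ∫ log (dP/dR) dP` if `P ≪ R` and the log-likelihood ratio is
`P`-integrable, and `+∞` otherwise. -/
noncomputable def klDiv {α : Type*} [MeasurableSpace α] (P R : Measure α) : EReal :=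
  if P ≪ R ∧ Integrable (llr P R) P then ((∫ x, llr P R x ∂P : ℝ) : EReal) else ⊤

/-- Joint law of `(X, Y)` where `X ~ Q` and `Y = X + Z` with `Z ~ N(0, σ²)`
independent of `X`. -/
noncomputable def jointLaw (σ : ℝ) (Q : Measure ℝ) : Measure (ℝ × ℝ) :=
  (Q.prod (gaussianReal 0 ⟨σ ^ 2, sq_nonneg σ⟩)).map (fun p => (p.1, p.1 + p.2))

/-- Mutual information `I(X;Y)` in nats: the KL divergence of the joint law of
`(X, Y)` from the product of its marginal laws. -/
noncomputable def mutualInfo (σ : ℝ) (Q : Measure ℝ) : EReal :=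
  klDiv (jointLaw σ Q) (((jointLaw σ Q).map Prod.fst).prod ((jointLaw σ Q).map Prod.snd))

/-- Capacity `C(A, E)` of the channel `Y = X + Z`, `Z ~ N(0, σ²)`, with peak-power
constraint `A` (i.e. `P(0 ≤ X ≤ A) = 1`) and average-power constraint `E[X] ≤ E`:
the supremum of the mutual information over all admissible input laws. -/
noncomputable def capacity (σ A E : ℝ) : EReal :=
  ⨆ Q ∈ {Q : Measure ℝ | IsProbabilityMeasure Q ∧ Q (Set.Icc 0 A) = 1 ∧
      ∫⁻ x, ENNReal.ofReal x ∂Q ≤ ENNReal.ofReal E}, mutualInfo σ Q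


/-- noise variance -/
noncomputable def vv (σ : ℝ) : NNReal := NNReal.mk (σ ^ 2) (sq_nonneg σ)

lemma vv_coe (σ : ℝ) : ((vv σ : NNReal) : ℝ) = σ ^ 2 := rfl

lemma vv_ne (σ : ℝ) (hσ : 0 < σ) : vv σ ≠ 0 := by
  intro h
  have := congrArg NNReal.toReal h
  rw [vv_coe] at this
  simp at this
  exact hσ.ne' this

lemma jointLaw_def (σ : ℝ) (Q : Measure ℝ) : jointLaw σ Q =
    (Q.prod (gaussianReal 0 (vv σ))).map (fun p => (p.1, p.1 + p.2)) := rfl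

/-- output density -/
noncomputable def gdens (v : NNReal) (Q : Measure ℝ) (y : ℝ) : ENNReal :=
  ∫⁻ x, gaussianPDF x v y ∂Q

lemma meas_pdf2 (v : NNReal) : Measurable (fun p : ℝ × ℝ => gaussianPDF p.1 v p.2) :=
  measurable_uncurry_gaussianPDF.comp
    (measurable_fst.prodMk (measurable_const.prodMk measurable_snd))

lemma meas_pdf1 (v : NNReal) (y : ℝ) : Measurable (fun x : ℝ => gaussianPDF x v y) := by
  unfold gaussianPDF gaussianPDFReal
  fun_prop

lemma meas_gdens (v : NNReal) (Q : Measure ℝ) [IsProbabilityMeasure Q] :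
    Measurable (gdens v Q) :=
  (meas_pdf2 v).lintegral_prod_left'

lemma pdf_le (v : NNReal) (x y : ℝ) :
    gaussianPDF x v y ≤ ENNReal.ofReal (√(2 * π * v))⁻¹ := by
  unfold gaussianPDF gaussianPDFReal
  apply ENNReal.ofReal_le_ofReal
  have h : rexp (-(y - x) ^ 2 / (2 * v)) ≤ 1 := by
    apply Real.exp_le_one_iff.2
    apply div_nonpos_of_nonpos_of_nonneg
    · nlinarith [sq_nonneg (y - x)]
    · positivity
  exact mul_le_of_le_one_right (by positivity) h

lemma gdens_ne_top (v : NNReal) (Q : Measure ℝ) [IsProbabilityMeasure Q] (y : ℝ) :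
    gdens v Q y ≠ ⊤ := by
  have : gdens v Q y ≤ ∫⁻ x, ENNReal.ofReal (√(2 * π * v))⁻¹ ∂Q :=
    lintegral_mono fun x => pdf_le v x y
  apply ne_top_of_le_ne_top _ this
  rw [lintegral_const, measure_univ, mul_one]
  exact ENNReal.ofReal_ne_top

lemma gdens_ne_zero (v : NNReal) (hv : v ≠ 0) (Q : Measure ℝ) [IsProbabilityMeasure Q] (y : ℝ) :
    gdens v Q y ≠ 0 := by
  intro h
  unfold gdens at h
  have hm : Measurable (fun x => gaussianPDF x v y) := meas_pdf1 v y
  rw [lintegral_eq_zero_iff hm] at h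
  have : ∀ᵐ x ∂Q, False := by
    filter_upwards [h] with x hx
    simp only [Pi.zero_apply] at hx
    exact (gaussianPDF_pos x hv y).ne' hx
  simp at this
  exact IsProbabilityMeasure.ne_zero Q this

lemma jointLaw_eq (σ : ℝ) (hσ : 0 < σ) (Q : Measure ℝ) [IsProbabilityMeasure Q] :
    jointLaw σ Q = (Q.prod volume).withDensity
      (fun p => gaussianPDF p.1 (vv σ) p.2) := by
  have hv : vv σ ≠ 0 := vv_ne σ hσ
  rw [jointLaw_def]
  generalize vv σ = v at hv ⊢
  refine Measure.ext_of_lintegral _ fun f hf => ?_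
  rw [lintegral_map hf (by fun_prop), lintegral_withDensity_eq_lintegral_mul _ (meas_pdf2 v) hf,
    lintegral_prod _ (by fun_prop), lintegral_prod]
  swap
  · exact ((meas_pdf2 v).mul hf).aemeasurable
  refine lintegral_congr fun x => ?_
  rw [gaussianReal_of_var_ne_zero _ hv,
    lintegral_withDensity_eq_lintegral_mul _ (measurable_gaussianPDF 0 v) (by fun_prop)]
  simp only [Pi.mul_apply]
  rw [← lintegral_add_left_eq_self (fun y => gaussianPDF x v y * f (x, y)) x]
  refine lintegral_congr fun y => ?_
  congr 1
  simp [gaussianPDF, gaussianPDFReal]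

lemma jointLaw_fst (σ : ℝ) (Q : Measure ℝ) [IsProbabilityMeasure Q] :
    (jointLaw σ Q).map Prod.fst = Q := by
  rw [jointLaw_def]
  rw [Measure.map_map measurable_fst (by fun_prop)]
  have : (Prod.fst ∘ fun p : ℝ × ℝ => (p.1, p.1 + p.2)) = Prod.fst := rfl
  rw [this, Measure.map_fst_prod]
  simp

lemma jointLaw_snd (σ : ℝ) (hσ : 0 < σ) (Q : Measure ℝ) [IsProbabilityMeasure Q] :
    (jointLaw σ Q).map Prod.snd = volume.withDensity (gdens (vv σ) Q) := by
  rw [jointLaw_eq σ hσ]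
  generalize vv σ = v
  refine Measure.ext_of_lintegral _ fun f hf => ?_
  have hm : Measurable (fun p : ℝ × ℝ => gaussianPDF p.1 v p.2 * f p.2) :=
    (meas_pdf2 v).mul (hf.comp measurable_snd)
  have h1 : ∫⁻ p, f p.2 ∂((Q.prod volume).withDensity (fun p => gaussianPDF p.1 v p.2)) =
      ∫⁻ p : ℝ × ℝ, gaussianPDF p.1 v p.2 * f p.2 ∂(Q.prod volume) :=
    lintegral_withDensity_eq_lintegral_mul _ (meas_pdf2 v) (hf.comp measurable_snd)
  rw [lintegral_map hf measurable_snd, h1,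
    lintegral_withDensity_eq_lintegral_mul _ (meas_gdens v Q) hf,
    lintegral_prod_symm _ hm.aemeasurable]
  refine lintegral_congr fun y => ?_
  have hm2 : Measurable (fun x => gaussianPDF x v y) := meas_pdf1 v y
  simp only [Pi.mul_apply, gdens]
  rw [lintegral_mul_const _ hm2]

lemma jointLaw_wd (σ : ℝ) (hσ : 0 < σ) (Q : Measure ℝ) [IsProbabilityMeasure Q] :
    jointLaw σ Q = (((jointLaw σ Q).map Prod.fst).prod ((jointLaw σ Q).map Prod.snd)).withDensity
      (fun p => gaussianPDF p.1 (vv σ) p.2 / gdens (vv σ) Q p.2) := by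
  have hv : vv σ ≠ 0 := vv_ne σ hσ
  rw [jointLaw_fst, jointLaw_snd σ hσ, jointLaw_eq σ hσ]
  generalize vv σ = v at hv ⊢
  have hg := meas_gdens v Q
  have hm : Measurable (fun p : ℝ × ℝ => gaussianPDF p.1 v p.2 / gdens v Q p.2) :=
    (meas_pdf2 v).div (by fun_prop)
  rw [prod_withDensity_right hg, ← withDensity_mul _ (by fun_prop) hm]
  congr 1
  ext p
  simp only [Pi.mul_apply]
  rw [ENNReal.mul_div_cancel (gdens_ne_zero v hv Q _) (gdens_ne_top v Q _)]

lemma mutualInfo_ge (σ : ℝ) (hσ : 0 < σ) (T : ℝ → ℝ) (hT : Measurable T) (B : ℝ × ℝ → ℝ)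
    (hB : Integrable B ((gaussianReal 0 1).prod (gaussianReal 0 1)))
    (hle : ∀ p : ℝ × ℝ, B p ≤
      Real.log (gaussianPDFReal 0 (vv σ) (σ * p.2)) -
      Real.log (gdens (vv σ) ((gaussianReal 0 1).map T) (T p.1 + σ * p.2)).toReal) :
    ((∫ p, B p ∂((gaussianReal 0 1).prod (gaussianReal 0 1)) : ℝ) : EReal)
      ≤ mutualInfo σ ((gaussianReal 0 1).map T) := by
  have hv : vv σ ≠ 0 := vv_ne σ hσ
  set Q := (gaussianReal 0 1).map T with hQ
  have : IsProbabilityMeasure Q := Measure.isProbabilityMeasure_map hT.aemeasurable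
  have hJ : jointLaw σ Q = ((gaussianReal 0 1).prod (gaussianReal 0 1)).map
      (fun p => (T p.1, T p.1 + σ * p.2)) := by
    have h1 : gaussianReal 0 (vv σ) = (gaussianReal 0 1).map (σ * ·) := by
      rw [gaussianReal_map_const_mul, mul_zero, mul_one]
      rfl
    rw [jointLaw_def]
    rw [h1, hQ, Measure.map_prod_map _ _ hT (by fun_prop), Measure.map_map (by fun_prop) (by fun_prop)]
    rfl
  have : IsProbabilityMeasure (jointLaw σ Q) := by
    rw [hJ]; exact Measure.isProbabilityMeasure_map (by fun_prop)
  have : IsProbabilityMeasure ((jointLaw σ Q).map Prod.fst) :=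
    Measure.isProbabilityMeasure_map (by fun_prop)
  have : IsProbabilityMeasure ((jointLaw σ Q).map Prod.snd) :=
    Measure.isProbabilityMeasure_map (by fun_prop)
  unfold mutualInfo klDiv
  split_ifs with h
  swap
  · exact le_top
  obtain ⟨hac, hint⟩ := h
  rw [EReal.coe_le_coe_iff]
  have hrn := Measure.rnDeriv_withDensity
    (((jointLaw σ Q).map Prod.fst).prod ((jointLaw σ Q).map Prod.snd))
    (f := (fun p => gaussianPDF p.1 (vv σ) p.2 / gdens (vv σ) Q p.2))
    ((meas_pdf2 _).div ((meas_gdens _ Q).comp measurable_snd))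
  rw [← jointLaw_wd σ hσ Q] at hrn
  have hrn2 := hac.ae_le hrn
  set ll := llr (jointLaw σ Q) (((jointLaw σ Q).map Prod.fst).prod ((jointLaw σ Q).map Prod.snd))
    with hll
  have hllm : Measurable ll := measurable_llr _ _
  have e1 : ∀ᵐ q ∂(jointLaw σ Q), ll q = Real.log
      (gaussianPDF q.1 (vv σ) q.2 / gdens (vv σ) Q q.2).toReal := by
    filter_upwards [hrn2] with q hq
    rw [hll, llr, hq]
  have hm : Measurable (fun p : ℝ × ℝ => (T p.1, T p.1 + σ * p.2)) := by fun_prop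
  clear_value ll
  rw [hJ] at e1 hint
  rw [hJ, integral_map hm.aemeasurable hllm.aestronglyMeasurable]
  rw [integrable_map_measure hllm.aestronglyMeasurable hm.aemeasurable] at hint
  refine integral_mono_ae hB hint ?_
  filter_upwards [ae_of_ae_map hm.aemeasurable e1] with p hp
  rw [hp]
  refine (hle p).trans (le_of_eq ?_)
  rw [ENNReal.toReal_div, Real.log_div, toReal_gaussianPDF]
  · congr 2
    simp [gaussianPDFReal]
  · rw [toReal_gaussianPDF]; exact (gaussianPDFReal_pos _ _ _ hv).ne'
  · exact ENNReal.toReal_ne_zero.2 ⟨gdens_ne_zero _ hv Q _, gdens_ne_top _ Q _⟩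

/-- standard normal density -/
noncomputable abbrev ph : ℝ → ℝ := gaussianPDFReal 0 1

/-- standard normal cdf -/
noncomputable def Ph (x : ℝ) : ℝ := cdf (gaussianReal 0 1) x

lemma ph_eq (x : ℝ) : ph x = (√(2 * π))⁻¹ * rexp (-x ^ 2 / 2) := by
  simp [ph, gaussianPDFReal]

lemma ph_pos (x : ℝ) : 0 < ph x := gaussianPDFReal_pos 0 1 x one_ne_zero

lemma ph_cont : Continuous ph := by
  have : ph = fun x => (√(2 * π))⁻¹ * rexp (-x ^ 2 / 2) := funext ph_eq
  rw [this]; fun_prop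

lemma log_ph (x : ℝ) : Real.log (ph x) = -(1 / 2 * Real.log (2 * π)) - x ^ 2 / 2 := by
  rw [ph_eq, Real.log_mul (by positivity) (by positivity), Real.log_inv, Real.log_exp,
    Real.log_sqrt (by positivity)]
  ring

lemma Ph_deriv (x : ℝ) : HasDerivAt Ph (ph x) x := by
  have hi : Integrable ph := integrable_gaussianPDFReal 0 1
  have h1 : ∀ y, Ph y = ∫ t in Iic y, ph t := by
    intro y
    unfold Ph
    rw [cdf_eq_real, measureReal_def, gaussianReal_apply_eq_integral 0 one_ne_zero,
      ENNReal.toReal_ofReal]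
    exact setIntegral_nonneg measurableSet_Iic fun t _ => (ph_pos t).le
  have h2 : ∀ y, Ph y = Ph 0 + ∫ t in (0:ℝ)..y, ph t := by
    intro y
    rw [h1 y, h1 0, ← intervalIntegral.integral_Iic_sub_Iic hi.integrableOn hi.integrableOn]
    ring
  have h3 : Ph = fun y => Ph 0 + ∫ t in (0:ℝ)..y, ph t := funext h2
  rw [h3]
  apply HasDerivAt.const_add
  exact intervalIntegral.integral_hasDerivAt_right hi.intervalIntegrable
    (ph_cont.stronglyMeasurableAtFilter _ _) ph_cont.continuousAt

lemma Ph_nonneg (x : ℝ) : 0 ≤ Ph x := cdf_nonneg _ x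
lemma Ph_le (x : ℝ) : Ph x ≤ 1 := cdf_le_one _ x
lemma Ph_cont : Continuous Ph := continuous_iff_continuousAt.2 fun x => (Ph_deriv x).continuousAt

lemma gauss_sq_int : Integrable (fun x : ℝ => x ^ 2) (gaussianReal 0 1) := by
  simpa using (memLp_id_gaussianReal (μ := 0) (v := 1) 2).integrable_sq

lemma gauss_id_int : Integrable (fun x : ℝ => x) (gaussianReal 0 1) := by
  exact (memLp_id_gaussianReal (μ := 0) (v := 1) 1).integrable (by simp)

lemma gauss_sq : ∫ x, x ^ 2 ∂(gaussianReal 0 1) = 1 := by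
  have := variance_fun_id_gaussianReal (μ := 0) (v := 1)
  rw [variance_eq_integral (by fun_prop)] at this
  simpa using this

lemma LL_int (κ : ℝ) (h0 : 0 < κ) (h1 : κ < 1) :
    Integrable (fun x => -Real.log (1 - κ * Ph x)) (gaussianReal 0 1) := by
  have hc := Ph_cont
  have hp : ∀ x, 1 - κ ≤ 1 - κ * Ph x := fun x => by nlinarith [Ph_le x]
  have hp' : ∀ x, 1 - κ * Ph x ≤ 1 := fun x => by nlinarith [Ph_nonneg x]
  refine Integrable.of_bound (C := -Real.log (1 - κ)) ?_ ?_
  · apply Measurable.aestronglyMeasurable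
    exact (Real.measurable_log.comp (by fun_prop)).neg
  · refine Filter.Eventually.of_forall fun x => ?_
    have a : Real.log (1 - κ) ≤ Real.log (1 - κ * Ph x) := Real.log_le_log (by linarith) (hp x)
    have b : Real.log (1 - κ * Ph x) ≤ 0 := Real.log_nonpos (by linarith [hp x]) (hp' x)
    rw [Real.norm_eq_abs, abs_of_nonneg (by linarith)]
    linarith

lemma LL_integral (κ : ℝ) (h0 : 0 < κ) (h1 : κ < 1) :
    ∫ x, -Real.log (1 - κ * Ph x) ∂(gaussianReal 0 1) =
      1 + (1 - κ) * Real.log (1 - κ) / κ := by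
  have hp : ∀ p, p ≤ 1 → 0 < 1 - κ * p := fun p hp => by nlinarith
  let H : ℝ → ℝ := fun p => ((1 - κ * p) * Real.log (1 - κ * p) - (1 - κ * p)) / κ
  have hH : ∀ p, p ≤ 1 → HasDerivAt H (-Real.log (1 - κ * p)) p := by
    intro p hp1
    have hl : HasDerivAt (fun p => 1 - κ * p) (-κ) p := by
      simpa using ((hasDerivAt_id p).const_mul κ).const_sub 1
    have := ((hl.mul (hl.log (hp p hp1).ne')).sub hl).div_const κ
    refine this.congr_deriv ?_
    have hne := (hp p hp1).ne'
    change (-κ * Real.log (1 - κ * p) + (1 - κ * p) * (-κ / (1 - κ * p)) - -κ) / κ =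
      -Real.log (1 - κ * p)
    rw [mul_div_cancel₀ _ hne]
    field_simp
    ring
  have hi := LL_int κ h0 h1
  rw [integral_gaussianReal_eq_integral_smul one_ne_zero]
  have hi2 : Integrable (fun x => ph x • (-Real.log (1 - κ * Ph x))) := by
    rw [gaussianReal_of_var_ne_zero _ one_ne_zero] at hi
    have hm : Measurable (gaussianPDF 0 1) := measurable_gaussianPDF 0 1
    rw [integrable_withDensity_iff_integrable_smul' hm
      (Filter.Eventually.of_forall fun x => gaussianPDF_lt_top)] at hi
    simpa only [toReal_gaussianPDF] using hi
  rw [integral_of_hasDerivAt_of_tendsto (f := fun x => H (Ph x)) (m := H 0) (n := H 1) _ hi2]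
  · simp only [H, mul_zero, mul_one, sub_zero, Real.log_one]
    field_simp
    ring
  · exact (hH 0 zero_le_one).continuousAt.tendsto.comp (tendsto_cdf_atBot _)
  · exact (hH 1 le_rfl).continuousAt.tendsto.comp (tendsto_cdf_atTop _)
  · intro x
    have := (hH (Ph x) (Ph_le x)).comp x (Ph_deriv x)
    rw [smul_eq_mul, mul_comm]
    exact this

lemma lintegral_comp_le (h h' : ℝ → ℝ) (hd : ∀ x, HasDerivAt h (h' x) x) (hpos : ∀ x, 0 < h' x)
    (f : ℝ → ENNReal) : ∫⁻ x, ENNReal.ofReal (h' x) * f (h x) ≤ ∫⁻ y, f y := by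
  have hmono : StrictMono h := strictMono_of_deriv_pos fun x => by
    rw [(hd x).deriv]; exact hpos x
  have := lintegral_image_eq_lintegral_abs_deriv_mul (s := Set.univ) (f := h) (f' := h')
    MeasurableSet.univ (fun x _ => (hd x).hasDerivWithinAt) hmono.injective.injOn f
  rw [Measure.restrict_univ] at this
  calc _ = ∫⁻ x, ENNReal.ofReal |h' x| * f (h x) := by
        refine lintegral_congr fun x => ?_
        rw [abs_of_pos (hpos x)]
    _ = _ := this.symm
    _ ≤ _ := setLIntegral_le_lintegral _ _

lemma key_lintegral (T T' : ℝ → ℝ) (hT : ∀ x, HasDerivAt T (T' x) x) (hT' : ∀ x, 0 < T' x)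
    (hmT' : Measurable T') (c s σ : ℝ) (hc : 0 < c) (hs : 0 < s) (hσ : 0 < σ)
    (hcs : c ^ 2 + s ^ 2 = 1) (gd : ℝ → ENNReal) (hgd : Measurable gd) (hg1 : ∫⁻ y, gd y ≤ 1) :
    ∫⁻ p : ℝ × ℝ, ENNReal.ofReal ((c * T' p.1 + σ * s) / ph (c * p.1 + s * p.2)) *
      gd (T p.1 + σ * p.2) ∂((gaussianReal 0 1).prod (gaussianReal 0 1)) ≤ 1 := by
  have hTm : Measurable T :=
    (continuous_iff_continuousAt.2 fun x => (hT x).continuousAt).measurable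
  have hphm : Measurable ph := ph_cont.measurable
  have hpm : Measurable (gaussianPDF 0 1) := measurable_gaussianPDF 0 1
  let F : ℝ → ℝ → ENNReal := fun g w => ENNReal.ofReal (ph w) *
    (ENNReal.ofReal (T' g + σ * s / c) * gd (T g + σ * ((w + s * g) / c)))
  have hF : Measurable (Function.uncurry F) := by
    simp only [F, Function.uncurry_def]; fun_prop
  rw [gaussianReal_of_var_ne_zero _ one_ne_zero, prod_withDensity hpm hpm,
    lintegral_withDensity_eq_lintegral_mul _ (by fun_prop) (by fun_prop)]
  have e1 : ∀ p : ℝ × ℝ, ((fun z : ℝ × ℝ => gaussianPDF 0 1 z.1 * gaussianPDF 0 1 z.2) *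
      (fun p : ℝ × ℝ => ENNReal.ofReal ((c * T' p.1 + σ * s) / ph (c * p.1 + s * p.2)) *
      gd (T p.1 + σ * p.2))) p = ENNReal.ofReal c * F p.1 (c * p.2 - s * p.1) := by
    rintro ⟨g, n⟩
    simp only [Pi.mul_apply, F, gaussianPDF]
    have h1 : T g + σ * ((c * n - s * g + s * g) / c) = T g + σ * n := by
      congr 2; field_simp; ring
    rw [h1, ← mul_assoc, ← mul_assoc, ← mul_assoc]
    congr 1
    have p1 := hT' g
    have p2 := ph_pos g
    have p3 := ph_pos n
    have p4 := ph_pos (c * n - s * g)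
    have p5 := ph_pos (c * g + s * n)
    rw [← ENNReal.ofReal_mul p2.le, ← ENNReal.ofReal_mul (by positivity),
      ← ENNReal.ofReal_mul hc.le, ← ENNReal.ofReal_mul (by positivity)]
    congr 1
    have h2 : ph g * ph n = ph (c * n - s * g) * ph (c * g + s * n) := by
      simp only [ph_eq]
      have : ∀ a b : ℝ, (√(2 * π))⁻¹ * rexp a * ((√(2 * π))⁻¹ * rexp b) =
          (√(2 * π))⁻¹ * (√(2 * π))⁻¹ * rexp (a + b) := by
        intro a b; rw [Real.exp_add]; ring
      rw [this, this]
      congr 2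
      linear_combination (-(g ^ 2 + n ^ 2) / 2) * (-hcs)
    rw [h2]
    generalize ph (c * g + s * n) = X at p5 ⊢
    field_simp
  rw [lintegral_congr e1]
  have hm2 : Measurable (fun p : ℝ × ℝ => ENNReal.ofReal c * F p.1 (c * p.2 - s * p.1)) := by
    have : Measurable (fun p : ℝ × ℝ => (p.1, c * p.2 - s * p.1)) := by fun_prop
    exact (hF.comp this).const_mul _
  rw [lintegral_prod _ hm2.aemeasurable]
  calc ∫⁻ g, ∫⁻ n, ENNReal.ofReal c * F g (c * n - s * g)
      ≤ ∫⁻ g, ∫⁻ w, F g w := by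
        refine lintegral_mono fun g => ?_
        refine lintegral_comp_le (fun n => c * n - s * g) (fun _ => c) (fun n => ?_)
          (fun _ => hc) (F g)
        simpa using ((hasDerivAt_id n).const_mul c).sub_const (s * g)
    _ = ∫⁻ w, ∫⁻ g, F g w := lintegral_lintegral_swap hF.aemeasurable
    _ ≤ ∫⁻ w, ENNReal.ofReal (ph w) := by
        refine lintegral_mono fun w => ?_
        simp only [F]
        rw [lintegral_const_mul _ (by fun_prop)]
        refine mul_le_of_le_one_right (by simp) (le_trans ?_ hg1)
        refine lintegral_comp_le (fun g => T g + σ * ((w + s * g) / c))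
          (fun g => T' g + σ * s / c) (fun g => ?_) (fun g => ?_) gd
        · have := (hT g).add (((((hasDerivAt_id g).const_mul s).const_add w).div_const c).const_mul σ)
          refine this.congr_deriv ?_
          field_simp
        · have := hT' g; positivity
    _ = 1 := lintegral_gaussianPDFReal_eq_one 0 one_ne_zero

lemma log_mix (m σ R t : ℝ) (hσ : 0 < σ) (hR : 0 < R) (hR2 : R ^ 2 = rexp m ^ 2 + σ ^ 2)
    (ht : 0 < t) :
    Real.log R + (rexp m / R) ^ 2 * (Real.log t - m) ≤
      Real.log (rexp m / R * t + σ * (σ / R)) := by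
  have hm := Real.exp_pos m
  have hs : (rexp m / R) ^ 2 + (σ / R) ^ 2 = 1 := by
    field_simp; linarith
  have h := strictConcaveOn_log_Ioi.concaveOn.2 (x := t / rexp m) (y := 1)
    (Set.mem_Ioi.2 (by positivity)) (Set.mem_Ioi.2 one_pos)
    (sq_nonneg (rexp m / R)) (sq_nonneg (σ / R)) hs
  simp only [smul_eq_mul, Real.log_one, mul_zero, add_zero, mul_one] at h
  rw [Real.log_div ht.ne' hm.ne', Real.log_exp] at h
  have e : rexp m / R * t + σ * (σ / R) =
      R * ((rexp m / R) ^ 2 * (t / rexp m) + (σ / R) ^ 2) := by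
    field_simp
  rw [e, Real.log_mul hR.ne' (by positivity)]
  linarith

lemma log_pdf_scale (σ n : ℝ) (hσ : 0 < σ) :
    Real.log (gaussianPDFReal 0 (vv σ) (σ * n)) = -Real.log σ + Real.log (ph n) := by
  have : gaussianPDFReal 0 (vv σ) (σ * n) = σ⁻¹ * ph n := by
    rw [ph_eq, gaussianPDFReal, vv_coe, Real.sqrt_mul (by positivity), Real.sqrt_sq hσ.le, mul_inv,
      mul_comm (√(2 * π))⁻¹, mul_assoc]
    congr 3
    field_simp
    ring
  rw [this, Real.log_mul (inv_ne_zero hσ.ne') (ph_pos n).ne', Real.log_inv]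

lemma gdens_lintegral (v : NNReal) (hv : v ≠ 0) (Q : Measure ℝ) [IsProbabilityMeasure Q] :
    ∫⁻ y, gdens v Q y ≤ 1 := by
  unfold gdens
  rw [lintegral_lintegral_swap]
  · simp [lintegral_gaussianPDF_eq_one _ hv]
  · exact ((meas_pdf2 v).comp measurable_swap).aemeasurable

lemma mi_bound (σ A μ αμ : ℝ) (hσ : 0 < σ) (hA : 0 < A) (hμ : 0 < μ)
    (κ : ℝ) (h0 : 0 < κ) (h1 : κ < 1)
    (hL : ∫ x, -Real.log (1 - κ * Ph x) ∂(gaussianReal 0 1) = αμ)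
    (m R : ℝ) (hm : m = Real.log (A * κ / μ) - 1 / 2 * Real.log (2 * π) - 1 / 2 + αμ)
    (hR : 0 < R) (hR2 : R ^ 2 = rexp m ^ 2 + σ ^ 2) :
    ((Real.log R - Real.log σ : ℝ) : EReal) ≤ mutualInfo σ
      ((gaussianReal 0 1).map (fun x => A / μ * -Real.log (1 - κ * Ph x))) := by
  set T : ℝ → ℝ := fun x => A / μ * -Real.log (1 - κ * Ph x) with hTdef
  set T' : ℝ → ℝ := fun x => A * κ / μ * ph x / (1 - κ * Ph x) with hT'def
  have hpp : ∀ x, 0 < 1 - κ * Ph x := fun x => by nlinarith [Ph_le x]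
  have hT : ∀ x, HasDerivAt T (T' x) x := by
    intro x
    have := ((((Ph_deriv x).const_mul κ).const_sub 1).log (hpp x).ne').neg.const_mul (A / μ)
    refine this.congr_deriv ?_
    simp only [hT'def]
    have := hpp x
    field_simp
  have hphc := ph_cont
  have hPhc := Ph_cont
  have hphm : Measurable ph := ph_cont.measurable
  have hPhm : Measurable Ph := Ph_cont.measurable
  have hT' : ∀ x, 0 < T' x := fun x => by
    have := hpp x
    have := ph_pos x
    positivity
  have hmT' : Measurable T' := by simp only [hT'def]; fun_prop
  have hTm : Measurable T :=
    (continuous_iff_continuousAt.2 fun x => (hT x).continuousAt).measurable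
  have hlog : ∀ x, Real.log (T' x) - m =
      -Real.log (1 - κ * Ph x) - αμ - x ^ 2 / 2 + 1 / 2 := by
    intro x
    simp only [hT'def]
    have := ph_pos x
    rw [Real.log_div (by positivity) (hpp x).ne', Real.log_mul (by positivity) this.ne', log_ph, hm]
    ring
  have hv := vv_ne σ hσ
  have hQp : IsProbabilityMeasure ((gaussianReal 0 1).map T) :=
    Measure.isProbabilityMeasure_map hTm.aemeasurable
  set c := rexp m / R with hc
  set s := σ / R with hs
  have hc0 : 0 < c := by positivity
  have hs0 : 0 < s := by positivity
  have hcs : c ^ 2 + s ^ 2 = 1 := by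
    rw [hc, hs]; field_simp; linarith
  set gd := gdens (vv σ) ((gaussianReal 0 1).map T) with hgd
  have hgdm : Measurable gd := meas_gdens _ _
  have key := key_lintegral T T' hT hT' hmT' c s σ hc0 hs0 hσ hcs gd hgdm (gdens_lintegral _ hv _)
  set D : ℝ × ℝ → ENNReal := fun p =>
    ENNReal.ofReal ((c * T' p.1 + σ * s) / ph (c * p.1 + s * p.2)) * gd (T p.1 + σ * p.2) with hD
  have hDm : Measurable D := by simp only [hD]; fun_prop
  have hDi : Integrable (fun p => (D p).toReal) ((gaussianReal 0 1).prod (gaussianReal 0 1)) :=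
    integrable_toReal_of_lintegral_ne_top hDm.aemeasurable
      (ne_top_of_le_ne_top ENNReal.one_ne_top key)
  have hDle : ∫ p, (D p).toReal ∂((gaussianReal 0 1).prod (gaussianReal 0 1)) ≤ 1 := by
    rw [integral_toReal hDm.aemeasurable]
    · exact ENNReal.toReal_le_of_le_ofReal zero_le_one (by simpa using key)
    · exact ae_lt_top hDm (ne_top_of_le_ne_top ENNReal.one_ne_top key)
  have hLi := LL_int κ h0 h1
  have i1 : Integrable (fun p : ℝ × ℝ => p.1 * p.2)
      ((gaussianReal 0 1).prod (gaussianReal 0 1)) := gauss_id_int.mul_prod gauss_id_int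
  have i2 : Integrable (fun p : ℝ × ℝ => p.2 ^ 2)
      ((gaussianReal 0 1).prod (gaussianReal 0 1)) := gauss_sq_int.comp_snd _
  have i3 : Integrable (fun p : ℝ × ℝ => -Real.log (1 - κ * Ph p.1))
      ((gaussianReal 0 1).prod (gaussianReal 0 1)) := hLi.comp_fst _
  have v1 : ∫ p : ℝ × ℝ, p.1 * p.2 ∂((gaussianReal 0 1).prod (gaussianReal 0 1)) = 0 := by
    rw [integral_prod_mul (fun x : ℝ => x) (fun x : ℝ => x), integral_id_gaussianReal]
    simp
  have v2 : ∫ p : ℝ × ℝ, p.2 ^ 2 ∂((gaussianReal 0 1).prod (gaussianReal 0 1)) = 1 := by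
    rw [integral_fun_snd (fun x : ℝ => x ^ 2), gauss_sq]
    simp
  have v3 : ∫ p : ℝ × ℝ, -Real.log (1 - κ * Ph p.1)
      ∂((gaussianReal 0 1).prod (gaussianReal 0 1)) = αμ := by
    rw [integral_fun_fst (fun x : ℝ => -Real.log (1 - κ * Ph x)), hL]
    simp
  let k : ℝ := (Real.log R - Real.log σ) + c ^ 2 / 2 - c ^ 2 * αμ + 1
  let B : ℝ × ℝ → ℝ := fun p => c * s * (p.1 * p.2) - c ^ 2 / 2 * p.2 ^ 2 +
    c ^ 2 * (-Real.log (1 - κ * Ph p.1)) + k - (D p).toReal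
  have j1 := i1.const_mul (c * s)
  have j2 := i2.const_mul (c ^ 2 / 2)
  have j3 := i3.const_mul (c ^ 2)
  have j4 : Integrable (fun _ : ℝ × ℝ => k) ((gaussianReal 0 1).prod (gaussianReal 0 1)) :=
    integrable_const _
  have q1 : Integrable (fun p : ℝ × ℝ => c * s * (p.1 * p.2) - c ^ 2 / 2 * p.2 ^ 2)
      ((gaussianReal 0 1).prod (gaussianReal 0 1)) := j1.sub j2
  have q2 : Integrable (fun p : ℝ × ℝ => c * s * (p.1 * p.2) - c ^ 2 / 2 * p.2 ^ 2 +
      c ^ 2 * (-Real.log (1 - κ * Ph p.1)))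
      ((gaussianReal 0 1).prod (gaussianReal 0 1)) := q1.add j3
  have q3 : Integrable (fun p : ℝ × ℝ => c * s * (p.1 * p.2) - c ^ 2 / 2 * p.2 ^ 2 +
      c ^ 2 * (-Real.log (1 - κ * Ph p.1)) + k)
      ((gaussianReal 0 1).prod (gaussianReal 0 1)) := q2.add j4
  have hBi : Integrable B ((gaussianReal 0 1).prod (gaussianReal 0 1)) :=
    q3.sub hDi
  have hBv : ∫ p, B p ∂((gaussianReal 0 1).prod (gaussianReal 0 1)) =
      c * s * 0 - c ^ 2 / 2 * 1 + c ^ 2 * αμ + k -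
        ∫ p, (D p).toReal ∂((gaussianReal 0 1).prod (gaussianReal 0 1)) := by
    simp only [B]
    rw [integral_sub q3 hDi, integral_add q2 j4,
      integral_add q1 j3, integral_sub j1 j2, integral_const_mul, integral_const_mul,
      integral_const_mul, v1, v2, v3]
    simp
  refine le_trans ?_ (mutualInfo_ge σ hσ T hTm B hBi ?_)
  · rw [EReal.coe_le_coe_iff, hBv]
    simp only [k]
    linarith
  · rintro ⟨g, n⟩
    rw [log_pdf_scale σ n hσ, log_ph]
    have hx : 0 < (gd (T g + σ * n)).toReal :=
      ENNReal.toReal_pos (gdens_ne_zero _ hv _ _) (gdens_ne_top _ _ _)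
    have hphU := ph_pos (c * g + s * n)
    have hTg := hT' g
    have hth : 0 < c * T' g + σ * s := by positivity
    have hDv : (D (g, n)).toReal =
        (c * T' g + σ * s) / ph (c * g + s * n) * (gd (T g + σ * n)).toReal := by
      simp only [hD]
      rw [ENNReal.toReal_mul, ENNReal.toReal_ofReal (by positivity)]
    have hl1 := Real.log_le_sub_one_of_pos (x := (D (g, n)).toReal) (by rw [hDv]; positivity)
    have hl2 : Real.log (D (g, n)).toReal = Real.log (c * T' g + σ * s) -
        Real.log (ph (c * g + s * n)) + Real.log (gd (T g + σ * n)).toReal := by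
      rw [hDv, Real.log_mul (by positivity) hx.ne', Real.log_div hth.ne' hphU.ne']
    rw [log_ph] at hl2
    have hl3 := log_mix m σ R (T' g) hσ hR hR2 hTg
    rw [hlog, ← hc, ← hs] at hl3
    simp only [B, k]
    have hs2 : s ^ 2 = 1 - c ^ 2 := by linarith
    have e : (c * g + s * n) ^ 2 = c ^ 2 * g ^ 2 + 2 * (c * s * (g * n)) + n ^ 2 - c ^ 2 * n ^ 2 := by
      linear_combination n ^ 2 * hs2
    rw [e] at hl2
    linarith

/-- Lower bound on `C(A, αA)` for `0 < α < 1/2`, where `μs` is the unique positive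
solution of `α = 1/μ − e^{−μ}/(1 − e^{−μ})`. -/
theorem capacity_lower_bound_strong (σ A α μs : ℝ) (hσ : 0 < σ) (hA : 0 < A)
    (hα₀ : 0 < α) (hα : α < 1 / 2) (hμs : 0 < μs)
    (hchar : α = 1 / μs - rexp (-μs) / (1 - rexp (-μs))) :
    ((1 / 2 * Real.log (1 + A ^ 2 * rexp (2 * α * μs) / (2 * π * rexp 1 * σ ^ 2) *
        ((1 - rexp (-μs)) / μs) ^ 2) : ℝ) : EReal) ≤ capacity σ A (α * A) := by
  have he1 : rexp (-μs) < 1 := by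
    rw [Real.exp_lt_one_iff]; linarith
  have he0 := Real.exp_pos (-μs)
  obtain ⟨κ, hκ⟩ : ∃ κ, κ = 1 - rexp (-μs) := ⟨_, rfl⟩
  have h0 : 0 < κ := by linarith
  have h1 : κ < 1 := by linarith
  have hexp : rexp (-μs) = 1 - κ := by linarith
  have hlogκ : Real.log (1 - κ) = -μs := by rw [← hexp, Real.log_exp]
  have hL : ∫ x, -Real.log (1 - κ * Ph x) ∂(gaussianReal 0 1) = α * μs := by
    rw [LL_integral κ h0 h1, hlogκ, hchar, ← hκ, hexp]
    field_simp
    ring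
  have hK : 0 < A * κ / μs := by positivity
  obtain ⟨m, hm⟩ : ∃ m, m = Real.log (A * κ / μs) - 1 / 2 * Real.log (2 * π) - 1 / 2 + α * μs :=
    ⟨_, rfl⟩
  have hm2 : rexp m ^ 2 = (A * κ / μs) ^ 2 * rexp (2 * α * μs) / (2 * π * rexp 1) := by
    have : rexp m ^ 2 = rexp (2 * m) := by rw [← Real.exp_nat_mul]; norm_num
    rw [this, hm]
    have : 2 * (Real.log (A * κ / μs) - 1 / 2 * Real.log (2 * π) - 1 / 2 + α * μs) =
        Real.log (A * κ / μs) + Real.log (A * κ / μs) + 2 * α * μs - Real.log (2 * π) - 1 := by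
      ring
    rw [this, Real.exp_sub, Real.exp_sub, Real.exp_add, Real.exp_add, Real.exp_log hK,
      Real.exp_log (by positivity)]
    field_simp
  have hRpos : 0 < rexp m ^ 2 + σ ^ 2 := by positivity
  have hmi := mi_bound σ A μs (α * μs) hσ hA hμs κ h0 h1 hL m (√(rexp m ^ 2 + σ ^ 2)) hm
    (Real.sqrt_pos.2 hRpos) (Real.sq_sqrt hRpos.le)
  have hval : 1 / 2 * Real.log (1 + A ^ 2 * rexp (2 * α * μs) / (2 * π * rexp 1 * σ ^ 2) *
        ((1 - rexp (-μs)) / μs) ^ 2) = Real.log (√(rexp m ^ 2 + σ ^ 2)) - Real.log σ := by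
    have e : 1 + A ^ 2 * rexp (2 * α * μs) / (2 * π * rexp 1 * σ ^ 2) *
        ((1 - rexp (-μs)) / μs) ^ 2 = (rexp m ^ 2 + σ ^ 2) / σ ^ 2 := by
      rw [hm2, ← hκ]
      field_simp
      ring
    rw [e, Real.log_div hRpos.ne' (by positivity), Real.log_sqrt hRpos.le, Real.log_pow]
    push_cast
    ring
  rw [hval]
  refine le_trans hmi ?_
  unfold capacity
  have hPhm : Measurable Ph := Ph_cont.measurable
  have hTm : Measurable (fun x => A / μs * -Real.log (1 - κ * Ph x)) :=
    ((Real.measurable_log.comp (by fun_prop)).neg).const_mul _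
  have hb : ∀ x, 0 ≤ -Real.log (1 - κ * Ph x) ∧ -Real.log (1 - κ * Ph x) ≤ μs := by
    intro x
    have a1 : 1 - κ ≤ 1 - κ * Ph x := by nlinarith [Ph_le x]
    have a2 : 1 - κ * Ph x ≤ 1 := by nlinarith [Ph_nonneg x]
    have b1 := Real.log_le_log (by linarith) a1
    have b2 := Real.log_nonpos (by linarith) a2
    constructor <;> linarith
  refine le_iSup₂_of_le ((gaussianReal 0 1).map (fun x => A / μs * -Real.log (1 - κ * Ph x)))
    ⟨Measure.isProbabilityMeasure_map hTm.aemeasurable, ?_, ?_⟩ le_rfl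
  · rw [Measure.map_apply hTm measurableSet_Icc]
    convert measure_univ (μ := gaussianReal 0 1)
    ext x
    simp only [Set.mem_preimage, Set.mem_Icc, Set.mem_univ, iff_true]
    obtain ⟨b1, b2⟩ := hb x
    refine ⟨by positivity, ?_⟩
    calc A / μs * -Real.log (1 - κ * Ph x) ≤ A / μs * μs := by gcongr
      _ = A := by field_simp
  · rw [lintegral_map ENNReal.measurable_ofReal hTm, ← ofReal_integral_eq_lintegral_ofReal
      ((LL_int κ h0 h1).const_mul _)]
    · rw [integral_const_mul, hL]
      apply le_of_eq
      congr 1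
      field_simp
    · refine Filter.Eventually.of_forall fun x => ?_
      have := (hb x).1
      simp only [Pi.zero_apply]
      positivity
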